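/- Let (G, p, L) be a minimum counterexample, minimizing the number of vertices and edges of G, to the following statement: 'Every plane graph G with no 5-cycle and no 6-cycle, with p ∈ V(G) and L a (*,1)-list assignment with |L(p)| = 1 and |L(v)| = 3 for all v ≠ p, is L-colorable.' Then G contains no 4-face not incident to p all four of whose incident vertices have degree exactly 3, and no 3-face incident to p. -/

import Mathlib

open Set

namespace ChoosSep

/-- `G` has a cycle of length `n`. -/
def HasCycleLen {V : Type} (G : SimpleGraph V) (n : ℕ) : Prop :=
  ∃ (v : V) (c : G.Walk v v), c.IsCycle ∧ c.length = n

/-- `G` has a proper coloring choosing each color from the list `L v`. -/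
def ColorableWith {V : Type} (G : SimpleGraph V) (L : V → Finset ℕ) : Prop :=
  ∃ φ : V → ℕ, (∀ v, φ v ∈ L v) ∧ ∀ ⦃u v⦄, G.Adj u v → φ u ≠ φ v

/-- `G` is `(k,d)`-choosable: it has an `L`-coloring for every list assignment
giving each vertex at least `k` colors and any two adjacent vertices at most `d`
common colors. -/
def Choosable {V : Type} (G : SimpleGraph V) (k d : ℕ) : Prop :=
  ∀ L : V → Finset ℕ, (∀ v, k ≤ (L v).card) →
    (∀ ⦃u v⦄, G.Adj u v → ((L u) ∩ (L v)).card ≤ d) →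
    ColorableWith G L

/-- The closed straight segment between two points of the plane. -/
def seg (x y : ℝ × ℝ) : Set (ℝ × ℝ) := segment ℝ x y

/-- A straight-line plane embedding of `G`: vertices go to distinct points, edges are
drawn as straight segments, two distinct edges meet only in common endpoints, and no
vertex lies on the drawing of an edge it does not belong to.  By Fáry's theorem a
finite simple graph admits such an embedding iff it is planar. -/
structure PlaneEmb {V : Type} (G : SimpleGraph V) where
  pos : V → ℝ × ℝ
  inj : Function.Injective pos
  edges_meet : ∀ ⦃a b c d : V⦄, G.Adj a b → G.Adj c d → s(a, b) ≠ s(c, d) →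
    seg (pos a) (pos b) ∩ seg (pos c) (pos d) ⊆ ({pos a, pos b} ∩ {pos c, pos d} : Set (ℝ × ℝ))
  vertex_off : ∀ ⦃a b v : V⦄, G.Adj a b → v ≠ a → v ≠ b → pos v ∉ seg (pos a) (pos b)

/-- `G` is planar: it admits a plane embedding. -/
def IsPlanar {V : Type} (G : SimpleGraph V) : Prop := Nonempty (PlaneEmb G)

variable {V : Type} {G : SimpleGraph V}

/-- The drawing of the graph in the plane: all vertex points and all edge segments. -/
def PlaneEmb.drawing (E : PlaneEmb G) : Set (ℝ × ℝ) :=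
  Set.range E.pos ∪ ⋃ (a : V) (b : V) (_ : G.Adj a b), seg (E.pos a) (E.pos b)

/-- A face of the embedding: a connected component of the complement of the drawing. -/
def PlaneEmb.IsFace (E : PlaneEmb G) (C : Set (ℝ × ℝ)) : Prop :=
  ∃ q, q ∉ E.drawing ∧ C = connectedComponentIn E.drawingᶜ q

/-- The outer face: the unbounded face. -/
def PlaneEmb.IsOuterFace (E : PlaneEmb G) (C : Set (ℝ × ℝ)) : Prop :=
  E.IsFace C ∧ ¬ Bornology.IsBounded C

/-- The vertices lying on the boundary of the face `C`. -/
def PlaneEmb.onFace (E : PlaneEmb G) (C : Set (ℝ × ℝ)) : Set V :=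
  {v | E.pos v ∈ closure C}

/-- An edge of `G` lying on the boundary of the face `C`. -/
def PlaneEmb.BoundaryEdge (E : PlaneEmb G) (C : Set (ℝ × ℝ)) (u v : V) : Prop :=
  G.Adj u v ∧ seg (E.pos u) (E.pos v) ⊆ closure C

/-- `C` is a 3-face with (mutually adjacent) incident vertices `x`, `y`, `z`. -/
def PlaneEmb.IsTriFace (E : PlaneEmb G) (C : Set (ℝ × ℝ)) (x y z : V) : Prop :=
  E.IsFace C ∧ G.Adj x y ∧ G.Adj y z ∧ G.Adj x z ∧
    frontier C = seg (E.pos x) (E.pos y) ∪ seg (E.pos y) (E.pos z) ∪ seg (E.pos x) (E.pos z)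

/-- `C` is a 4-face with incident 4-cycle `w x y z`. -/
def PlaneEmb.IsQuadFace (E : PlaneEmb G) (C : Set (ℝ × ℝ)) (w x y z : V) : Prop :=
  E.IsFace C ∧ G.Adj w x ∧ G.Adj x y ∧ G.Adj y z ∧ G.Adj z w ∧ w ≠ y ∧ x ≠ z ∧
    frontier C = seg (E.pos w) (E.pos x) ∪ seg (E.pos x) (E.pos y) ∪
      seg (E.pos y) (E.pos z) ∪ seg (E.pos z) (E.pos w)

/-- `x z1 y z2` is a diamond: a 4-cycle formed by two adjacent 3-faces
`x y z1` and `x y z2` sharing the edge `x y`. -/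
def PlaneEmb.IsDiamond (E : PlaneEmb G) (x z1 y z2 : V) : Prop :=
  z1 ≠ z2 ∧ ∃ C1 C2 : Set (ℝ × ℝ), C1 ≠ C2 ∧ E.IsTriFace C1 x y z1 ∧ E.IsTriFace C2 x y z2

/-- The union of the three sides of the triangle `a b c`. -/
def triBoundary (a b c : ℝ × ℝ) : Set (ℝ × ℝ) := seg a b ∪ seg b c ∪ seg a c

/-- The open interior region of the triangle `a b c`: points off the triangle whose
connected component in the complement of the triangle is bounded. -/
def triInterior (a b c : ℝ × ℝ) : Set (ℝ × ℝ) :=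
  {p | p ∉ triBoundary a b c ∧
    Bornology.IsBounded (connectedComponentIn (triBoundary a b c)ᶜ p)}

/-- The degree of a vertex. -/
noncomputable def deg (G : SimpleGraph V) (v : V) : ℕ := Nat.card {u : V // G.Adj v u}

/-- `G` is 2-connected: connected and with no cutvertex. -/
def TwoConnected (G : SimpleGraph V) : Prop :=
  G.Connected ∧ ∀ v : V, (G.induce {u : V | u ≠ v}).Connected

/-- A configuration for Theorem 8: a plane graph with no 5-cycle and no 6-cycle, a
vertex `p`, and a `(*,1)`-list assignment with `|L(p)| = 1` and `|L(v)| = 3`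
for every other vertex. -/
structure Cfg56 where
  n : ℕ
  G : SimpleGraph (Fin n)
  E : PlaneEmb G
  p : Fin n
  L : Fin n → Finset ℕ

namespace Cfg56

/-- All hypotheses of Theorem 8 hold for the configuration. -/
def Valid (C : Cfg56) : Prop :=
  (¬ HasCycleLen C.G 5) ∧ (¬ HasCycleLen C.G 6) ∧
  (∀ ⦃u v⦄, C.G.Adj u v → ((C.L u) ∩ (C.L v)).card ≤ 1) ∧
  (C.L C.p).card = 1 ∧
  (∀ v, v ≠ C.p → (C.L v).card = 3)

/-- The configuration admits an `L`-coloring. -/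
def Colorable (C : Cfg56) : Prop := ColorableWith C.G C.L

/-- The quantity `|V(G)| + |E(G)|`. -/
noncomputable def measure (C : Cfg56) : ℕ := C.n + Nat.card ↥C.G.edgeSet

/-- `C` is a minimum counterexample to Theorem 8: it satisfies the hypotheses, has no
`L`-coloring, and minimizes `|V(G)| + |E(G)|` among all such counterexamples. -/
def MinCounterexample (C : Cfg56) : Prop :=
  C.Valid ∧ ¬ C.Colorable ∧
    ∀ D : Cfg56, D.Valid → ¬ D.Colorable → C.measure ≤ D.measure

end Cfg56

/-- Edge deletion preserves plane embeddings. -/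
def PlaneEmb.mono {H : SimpleGraph V} (E : PlaneEmb G) (h : H ≤ G) : PlaneEmb H where
  pos := E.pos
  inj := E.inj
  edges_meet _ _ _ _ hab hcd := E.edges_meet (h hab) (h hcd)
  vertex_off _ _ _ hab := E.vertex_off (h hab)

theorem HasCycleLen.mono {H : SimpleGraph V} {n : ℕ} (h : H ≤ G) (hH : HasCycleLen H n) :
    HasCycleLen G n := by
  obtain ⟨v, c, hc, hl⟩ := hH
  exact ⟨v, c.mapLe h, hc.mapLe h, by simpa using hl⟩

/-- Every proper spanning subgraph of a minimum counterexample is colorable. -/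
theorem Cfg56.MinCounterexample.colorableWith_of_lt {C : Cfg56} (hC : C.MinCounterexample)
    {H : SimpleGraph (Fin C.n)} (h : H < C.G) : ColorableWith H C.L := by
  by_contra hH
  obtain ⟨⟨h5, h6, hL, hp, h3⟩, -, hmin⟩ := hC
  have hle := hmin ⟨C.n, H, C.E.mono h.le, C.p, C.L⟩
    ⟨fun hc => h5 (hc.mono h.le), fun hc => h6 (hc.mono h.le),
      fun u v huv => hL (h.le huv), hp, h3⟩ hH
  have hlt : Nat.card H.edgeSet < Nat.card C.G.edgeSet :=
    Set.ncard_lt_ncard (SimpleGraph.edgeSet_ssubset_edgeSet.2 h) (Set.toFinite _)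
  simp only [Cfg56.measure] at hle
  omega

theorem deleteEdges_singleton_lt {u v : V} (h : G.Adj u v) : G.deleteEdges {s(u, v)} < G := by
  refine lt_of_le_of_ne (G.deleteEdges_le _) fun he => ?_
  rw [← he] at h
  simp at h

theorem Cfg56.MinCounterexample.color_mem_of_adj {C : Cfg56} (hC : C.MinCounterexample)
    {c : ℕ} (hc : C.L C.p = {c}) {x : Fin C.n} (hx : C.G.Adj C.p x) : c ∈ C.L x := by
  by_contra hcx
  obtain ⟨φ, hφ, hadj⟩ := hC.colorableWith_of_lt (deleteEdges_singleton_lt hx)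
  have hφp : φ C.p = c := by simpa [hc] using hφ C.p
  have hne : φ C.p ≠ φ x := fun he => hcx (hφp ▸ he ▸ hφ x)
  refine hC.2.1 ⟨φ, hφ, fun u v huv => ?_⟩
  by_cases he : s(u, v) = s(C.p, x)
  · rcases Sym2.eq_iff.1 he with ⟨rfl, rfl⟩ | ⟨rfl, rfl⟩
    exacts [hne, hne.symm]
  · exact hadj ((SimpleGraph.deleteEdges_adj ..).2 ⟨huv, he⟩)

theorem Cfg56.MinCounterexample.not_triangle {C : Cfg56} (hC : C.MinCounterexample)
    {x y : Fin C.n} (hx : C.G.Adj C.p x) (hy : C.G.Adj C.p y) (hxy : C.G.Adj x y) : False := by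
  obtain ⟨c, hc⟩ := Finset.card_eq_one.1 hC.1.2.2.2.1
  have hcx := hC.color_mem_of_adj hc hx
  have hcy := hC.color_mem_of_adj hc hy
  obtain ⟨φ, hφ, hadj⟩ := hC.colorableWith_of_lt (deleteEdges_singleton_lt hxy)
  have hφp : φ C.p = c := by simpa [hc] using hφ C.p
  have hne : φ x ≠ φ y := by
    intro he
    have hφx : φ x = c := Finset.card_le_one.1 (hC.1.2.2.1 hxy) _
      (Finset.mem_inter.2 ⟨hφ x, he ▸ hφ y⟩) _ (Finset.mem_inter.2 ⟨hcx, hcy⟩)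
    refine hadj (u := C.p) (v := x) ((SimpleGraph.deleteEdges_adj ..).2 ⟨hx, ?_⟩)
      (hφp.trans hφx.symm)
    simp [hx.ne, hy.ne]
  refine hC.2.1 ⟨φ, hφ, fun u v huv => ?_⟩
  by_cases he : s(u, v) = s(x, y)
  · rcases Sym2.eq_iff.1 he with ⟨rfl, rfl⟩ | ⟨rfl, rfl⟩
    exacts [hne, hne.symm]
  · exact hadj ((SimpleGraph.deleteEdges_adj ..).2 ⟨huv, he⟩)

/-- A list of three colors at a vertex `v` of degree 3 has a color avoiding, for all neighbors
`u` of `v` but one, a set that meets the list at most once. -/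
theorem exists_color_avoiding [Fintype V] {v r : V} (hr : G.Adj v r) (hv : deg G v = 3)
    {A : Finset ℕ} (hA : A.card = 3) (B : V → Finset ℕ)
    (hB : ∀ u, G.Adj v u → (A ∩ B u).card ≤ 1) :
    ∃ c ∈ A, ∀ u, G.Adj v u → u ≠ r → c ∉ B u := by
  classical
  have hN : ((G.neighborFinset v).erase r).card = 2 := by
    rw [Finset.card_erase_of_mem (by simpa using hr), SimpleGraph.card_neighborFinset_eq_degree,
      ← SimpleGraph.card_neighborSet_eq_degree, ← Nat.card_eq_fintype_card]
    exact congrArg (· - 1) hv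
  have hbad : (((G.neighborFinset v).erase r).biUnion fun u => A ∩ B u).card < A.card := by
    have := Finset.card_biUnion_le_card_mul ((G.neighborFinset v).erase r)
      (fun u => A ∩ B u) 1 fun u hu => hB u (by simpa using (Finset.mem_erase.1 hu).2)
    omega
  obtain ⟨c, hcA, hc⟩ := Finset.exists_mem_notMem_of_card_lt_card hbad
  refine ⟨c, hcA, fun u hu hur hcu => hc ?_⟩
  exact Finset.mem_biUnion.2 ⟨u, by simp [hu, hur], Finset.mem_inter.2 ⟨hcA, hcu⟩⟩

/-- A minimum counterexample has no nonempty set of vertices of degree 3 avoiding `p` in which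
every vertex has a chosen neighbor within the set, no two vertices having chosen each other. -/
theorem Cfg56.MinCounterexample.not_cubic_set {C : Cfg56} (hC : C.MinCounterexample)
    {S : Set (Fin C.n)} (hS : S.Nonempty) (hp : C.p ∉ S) (hdeg : ∀ v ∈ S, deg C.G v = 3)
    (r : Fin C.n → Fin C.n) (hr : ∀ v ∈ S, C.G.Adj v (r v)) (hrS : ∀ v ∈ S, r v ∈ S)
    (hrr : ∀ v ∈ S, r (r v) ≠ v) : False := by
  classical
  let H : SimpleGraph (Fin C.n) :=
    { Adj := fun u v => C.G.Adj u v ∧ u ∉ S ∧ v ∉ S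
      symm := ⟨fun u v h => ⟨h.1.symm, h.2.2, h.2.1⟩⟩
      loopless := ⟨fun u h => h.1.ne rfl⟩ }
  have hH : H < C.G := by
    refine lt_of_le_of_ne (fun u v h => h.1) fun he => ?_
    obtain ⟨v, hv⟩ := hS
    have h := hr v hv
    rw [← he] at h
    exact h.2.1 hv
  obtain ⟨ψ, hψ, hadj⟩ := hC.colorableWith_of_lt hH
  let B : Fin C.n → Finset ℕ := fun u => if u ∈ S then C.L u else {ψ u}
  have hex : ∀ v, ∃ c ∈ C.L v, (v ∉ S → c = ψ v) ∧
      (v ∈ S → ∀ u, C.G.Adj v u → u ≠ r v → c ∉ B u) := by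
    intro v
    by_cases hv : v ∈ S
    · obtain ⟨c, hc, h⟩ := exists_color_avoiding (hr v hv) (hdeg v hv)
        (hC.1.2.2.2.2 v fun h => hp (h ▸ hv)) B fun u hu => by
          by_cases huS : u ∈ S
          · simpa [B, huS] using hC.1.2.2.1 hu
          · simpa [B, huS] using Finset.card_le_card
              (Finset.inter_subset_right (s₁ := C.L v) (s₂ := {ψ u}))
      exact ⟨c, hc, fun h => absurd hv h, fun _ => h⟩
    · exact ⟨ψ v, hψ v, fun _ => rfl, fun h => absurd h hv⟩
  choose φ hφ hout hin using hex
  have hφB : ∀ u, φ u ∈ B u := by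
    intro u
    by_cases hu : u ∈ S
    · simpa [B, hu] using hφ u
    · simpa [B, hu] using hout u hu
  have key : ∀ ⦃u v⦄, C.G.Adj u v → u ∈ S → v ≠ r u → φ u ≠ φ v :=
    fun u v huv hu hvr he => hin u hu v huv hvr (he ▸ hφB v)
  refine hC.2.1 ⟨φ, hφ, fun u v huv => ?_⟩
  by_cases hu : u ∈ S
  · by_cases hvr : v = r u
    · have hv : v ∈ S := hvr ▸ hrS u hu
      exact (key huv.symm hv fun h => hrr u hu (by rw [← hvr, ← h])).symm
    · exact key huv hu hvr
  · by_cases hv : v ∈ S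
    · exact (key huv.symm hv fun h => hu (h ▸ hrS v hv)).symm
    · rw [hout u hu, hout v hv]
      exact hadj ⟨huv, hu, hv⟩

/-- **Configurations (C1) and (C2) are reducible.** A minimum counterexample to
Theorem 8 has no normal 4-face (one not incident to `p`) all of whose incident
vertices have degree exactly 3, and no 3-face incident to `p`. -/
theorem min_cex_C5C6free_no_lowquad_no_triface_at_p (C : Cfg56)
    (hC : C.MinCounterexample) :
    (¬ ∃ (A : Set (ℝ × ℝ)) (w x y z : Fin C.n), C.E.IsQuadFace A w x y z ∧
      C.p ∉ ({w, x, y, z} : Set (Fin C.n)) ∧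
      deg C.G w = 3 ∧ deg C.G x = 3 ∧ deg C.G y = 3 ∧ deg C.G z = 3) ∧
    (¬ ∃ (A : Set (ℝ × ℝ)) (x y z : Fin C.n), C.E.IsTriFace A x y z ∧
      C.p ∈ ({x, y, z} : Set (Fin C.n))) := by
  refine ⟨?_, ?_⟩
  · rintro ⟨A, w, x, y, z, ⟨-, hwx, hxy, hyz, hzw, hwy, hxz, -⟩, hp, hw, hx, hy, hz⟩
    have hwx' := hwx.ne
    have hxy' := hxy.ne
    have hyz' := hyz.ne
    have hzw' := hzw.ne
    refine hC.not_cubic_set (S := {w, x, y, z}) ⟨w, by simp⟩ hp ?_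
      (fun v => if v = w then x else if v = x then y else if v = y then z else w) ?_ ?_ ?_ <;>
    · simp only [mem_insert_iff, mem_singleton_iff]
      grind
  · rintro ⟨A, x, y, z, ⟨-, hxy, hyz, hxz, -⟩, rfl | rfl | rfl⟩
    exacts [hC.not_triangle hxy hxz hyz, hC.not_triangle hxy.symm hyz hxz,
      hC.not_triangle hxz.symm hyz.symm hxy]

end ChoosSep
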